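/- The Ehrhart δ-polynomial of the Lawrence polytope P_B satisfies δ_B(t) = Σ_{F ∈ M_B} #(BOX(F) ∩ ℤ^d) · t^{dim F} · h_F(t). -/

import Mathlib

open scoped BigOperators Pointwise
open Polynomial

noncomputable section

namespace LawrencePaper

attribute [local instance] Classical.propDecidable

/-- The real vector associated to an integer vector. -/
def toR (d : ℕ) (v : Fin d → ℤ) : Fin d → ℝ := fun j => (v j : ℝ)

/-- The `i`-th standard basis vector of `ℝ^n`. -/
def e (n : ℕ) (i : Fin n) : Fin n → ℝ := Pi.single i 1

/-- The Lawrence polytope of the configuration `b`: the convex hull of the points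
`(b i, e i)` and `(0, e i)`. -/
def lawrencePolytope (d n : ℕ) (b : Fin n → Fin d → ℤ) : Set ((Fin d → ℝ) × (Fin n → ℝ)) :=
  convexHull ℝ
    ((Set.range fun i => (toR d (b i), e n i)) ∪
      (Set.range fun i => ((0 : Fin d → ℝ), e n i)))

/-- The number of lattice points in the `m`-th dilate of `P`. -/
def latticeCount (d n : ℕ) (P : Set ((Fin d → ℝ) × (Fin n → ℝ))) (m : ℕ) : ℕ :=
  Nat.card {z : (Fin d → ℤ) × (Fin n → ℤ) |
    (toR d z.1, fun j => (z.2 j : ℝ)) ∈ (m : ℝ) • P}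

/-- `δ` is the Ehrhart δ-polynomial of the `(d+n-1)`-dimensional polytope `P ⊆ ℝ^{d+n}`:
it has degree at most `n+d-1` and satisfies
`(1-t)^{n+d} * Σ_{m ≥ 0} f_P(m) t^m = δ(t)` as formal power series. -/
def IsDeltaPoly (d n : ℕ) (P : Set ((Fin d → ℝ) × (Fin n → ℝ))) (δ : Polynomial ℤ) : Prop :=
  δ.natDegree ≤ n + d - 1 ∧
    (1 - PowerSeries.X) ^ (n + d) *
      PowerSeries.mk (fun m => (latticeCount d n P m : ℤ)) = (δ : PowerSeries ℤ)

/-- Membership in the matroid `M_B`: the index set `F` corresponds to a linearly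
independent subset of the configuration. -/
def memMatroid (d n : ℕ) (b : Fin n → Fin d → ℤ) (F : Finset (Fin n)) : Prop :=
  LinearIndependent ℝ (fun i : F => toR d (b i.1))

/-- The linear span of the vectors indexed by `F`. -/
def spanF (d n : ℕ) (b : Fin n → Fin d → ℤ) (F : Finset (Fin n)) : Submodule ℝ (Fin d → ℝ) :=
  Submodule.span ℝ ((fun i => toR d (b i)) '' F)

/-- The dimension of an element `F` of the matroid: the dimension of its span. -/
def dimF (d n : ℕ) (b : Fin n → Fin d → ℤ) (F : Finset (Fin n)) : ℕ :=
  Module.finrank ℝ (spanF d n b F)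

/-- `BOX(F) = { Σ_{i ∈ F} α_i b_i  :  0 < α_i < 1 }`; `BOX(∅) = {0}`. -/
def box (d n : ℕ) (b : Fin n → Fin d → ℤ) (F : Finset (Fin n)) : Set (Fin d → ℝ) :=
  {x | ∃ α : Fin n → ℝ, (∀ i ∈ F, 0 < α i ∧ α i < 1) ∧ x = ∑ i ∈ F, α i • toR d (b i)}

/-- The number of lattice points in `BOX(F)`. -/
def boxCount (d n : ℕ) (b : Fin n → Fin d → ℤ) (F : Finset (Fin n)) : ℕ :=
  Nat.card {z : Fin d → ℤ | toR d z ∈ box d n b F}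

/-- Membership in the restricted matroid `M_F`: the index set `G` corresponds to a linearly
independent subset of the induced configuration `B_F` in `ℝ^d / Span F`. -/
def memMatroidRes (d n : ℕ) (b : Fin n → Fin d → ℤ) (F G : Finset (Fin n)) : Prop :=
  (∀ i ∈ G, toR d (b i) ∉ spanF d n b F) ∧
    LinearIndependent ℝ (fun i : G => (spanF d n b F).mkQ (toR d (b i.1)))

/-- The dimension of an element `G` of the restricted matroid `M_F`: the dimension of the
span of the corresponding vectors in `ℝ^d / Span F`. -/
def dimRes (d n : ℕ) (b : Fin n → Fin d → ℤ) (F G : Finset (Fin n)) : ℕ :=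
  Module.finrank ℝ (Submodule.span ℝ ((fun i => (spanF d n b F).mkQ (toR d (b i))) '' G))

/-- `f_i`: the number of elements of the restricted matroid `M_F` of dimension `i`. -/
def fRes (d n : ℕ) (b : Fin n → Fin d → ℤ) (F : Finset (Fin n)) (i : ℕ) : ℕ :=
  Nat.card {G : Finset (Fin n) | memMatroidRes d n b F G ∧ dimRes d n b F G = i}

/-- The `h`-polynomial `h_F(t) = Σ_{i=0}^{codim F} f_i t^i (1-t)^{codim F - i}` of `M_F`. -/
def hPoly (d n : ℕ) (b : Fin n → Fin d → ℤ) (F : Finset (Fin n)) : Polynomial ℤ :=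
  ∑ i ∈ Finset.range (d - dimF d n b F + 1),
    C (fRes d n b F i : ℤ) * X ^ i * (1 - X) ^ (d - dimF d n b F - i)

/-- The hyperplane `H_i = {u : ⟨u, b_i⟩ = r_i}`. -/
def hyperplane (d n : ℕ) (b : Fin n → Fin d → ℤ) (r : Fin n → ℝ) (i : Fin n) :
    Set (Fin d → ℝ) :=
  {u | ∑ j, u j * (b i j : ℝ) = r i}

/-- The arrangement `H` is simple: the intersection of any `l` of the hyperplanes is
either empty or has codimension `l`. -/
def Simple (d n : ℕ) (b : Fin n → Fin d → ℤ) (r : Fin n → ℝ) : Prop :=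
  ∀ s : Finset (Fin n), (⋂ i ∈ s, hyperplane d n b r i) = ∅ ∨
    ∀ x ∈ ⋂ i ∈ s, hyperplane d n b r i,
      Module.finrank ℝ
        (Submodule.span ℝ ((fun u => u - x) '' ⋂ i ∈ s, hyperplane d n b r i)) + s.card = d

/-- The affine subspace `A_F = ⋂_{i ∈ F} H_i`. -/
def flat (d n : ℕ) (b : Fin n → Fin d → ℤ) (r : Fin n → ℝ) (F : Finset (Fin n)) :
    Set (Fin d → ℝ) :=
  ⋂ i ∈ F, hyperplane d n b r i

/-- The cell of the restricted arrangement `H^F` containing the point `u ∈ A_F`: all points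
of `A_F` satisfying the same relations `<`, `=`, `>` as `u` with respect to each hyperplane
of `H^F`. -/
def cellOf (d n : ℕ) (b : Fin n → Fin d → ℤ) (r : Fin n → ℝ) (F : Finset (Fin n))
    (u : Fin d → ℝ) : Set (Fin d → ℝ) :=
  {v ∈ flat d n b r F | ∀ i : Fin n, toR d (b i) ∉ spanF d n b F →
    (((∑ j, v j * (b i j : ℝ)) < r i ↔ (∑ j, u j * (b i j : ℝ)) < r i) ∧
      ((∑ j, v j * (b i j : ℝ)) = r i ↔ (∑ j, u j * (b i j : ℝ)) = r i))}

/-- `f^bd_k`: the number of bounded cells of the restricted arrangement `H^F` of dimension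
`k` (the dimension of a cell being the dimension of its affine span). -/
def fBd (d n : ℕ) (b : Fin n → Fin d → ℤ) (r : Fin n → ℝ) (F : Finset (Fin n)) (k : ℕ) : ℕ :=
  Nat.card {Cs : Set (Fin d → ℝ) | (∃ u ∈ flat d n b r F, Cs = cellOf d n b r F u) ∧
    Bornology.IsBounded Cs ∧ Module.finrank ℝ (vectorSpan ℝ Cs) = k}

/-- `h^bd_F(t) = Σ_{i=0}^{codim F} f^bd_i (t-1)^i`. -/
def hBdPoly (d n : ℕ) (b : Fin n → Fin d → ℤ) (r : Fin n → ℝ) (F : Finset (Fin n)) :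
    Polynomial ℤ :=
  ∑ i ∈ Finset.range (d - dimF d n b F + 1), C (fBd d n b r F i : ℤ) * (X - 1) ^ i

/-- The complement within `A_F` of the union of the hyperplanes of `H^F`. -/
def arrComplement (d n : ℕ) (b : Fin n → Fin d → ℤ) (r : Fin n → ℝ) (F : Finset (Fin n)) :
    Set (Fin d → ℝ) :=
  flat d n b r F \ ⋃ i ∈ {i : Fin n | toR d (b i) ∉ spanF d n b F}, hyperplane d n b r i

/-- `R^bd_F`: the number of bounded regions (connected components of the complement within
`A_F` of the union of the hyperplanes) of the restricted arrangement `H^F`. -/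
def boundedRegionCount (d n : ℕ) (b : Fin n → Fin d → ℤ) (r : Fin n → ℝ)
    (F : Finset (Fin n)) : ℕ :=
  Nat.card {R : Set (Fin d → ℝ) | (∃ x ∈ arrComplement d n b r F,
    R = connectedComponentIn (arrComplement d n b r F) x) ∧ Bornology.IsBounded R}

/-- `F` is a maximal linearly independent subset of the configuration. -/
def IsMaximalIndep (d n : ℕ) (b : Fin n → Fin d → ℤ) (F : Finset (Fin n)) : Prop :=
  memMatroid d n b F ∧ ∀ G : Finset (Fin n), memMatroid d n b G → F ⊆ G → F = G

/-- The matroid `M_B` is coloop free: no element of the configuration lies in every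
maximal linearly independent subset. -/
def ColoopFree (d n : ℕ) (b : Fin n → Fin d → ℤ) : Prop :=
  ∀ i : Fin n, ∃ F : Finset (Fin n), IsMaximalIndep d n b F ∧ i ∉ F

/-- `f_i`: the number of elements of the matroid `M_B` of dimension `i`. -/
def fMat (d n : ℕ) (b : Fin n → Fin d → ℤ) (i : ℕ) : ℕ :=
  Nat.card {F : Finset (Fin n) | memMatroid d n b F ∧ dimF d n b F = i}


/-- The elements of `A` whose image in `V` lies in the zonotope `∑ i ∈ S, [0, y i • φ (b i)]`. -/
def zonotopePts {A V ι : Type*} [AddCommGroup A] [AddCommGroup V] [Module ℝ V]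
    (φ : A →+ V) (b : ι → A) (S : Finset ι) (y : ι → ℕ) : Set A :=
  {a | ∃ l : ι → ℝ, (∀ i ∈ S, 0 ≤ l i ∧ l i ≤ y i) ∧ φ a = ∑ i ∈ S, l i • φ (b i)}

/-- The elements of `A` whose image in `V` lies in the half-open box
`∑ i ∈ S, [0, 1) • φ (b i)`. -/
def halfOpenPts {A V ι : Type*} [AddCommGroup A] [AddCommGroup V] [Module ℝ V]
    (φ : A →+ V) (b : ι → A) (S : Finset ι) : Set A :=
  {a | ∃ l : ι → ℝ, (∀ i ∈ S, 0 ≤ l i ∧ l i < 1) ∧ φ a = ∑ i ∈ S, l i • φ (b i)}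

/-- The map `A / ℤ c → V / ℝ (φ c)` induced by `φ : A → V`. -/
def contract {A V : Type*} [AddCommGroup A] [AddCommGroup V] [Module ℝ V]
    (φ : A →+ V) (c : A) : A ⧸ AddSubgroup.zmultiples c →+ V ⧸ Submodule.span ℝ {φ c} :=
  QuotientAddGroup.lift _ ((Submodule.mkQ (Submodule.span ℝ {φ c})).toAddMonoidHom.comp φ) (by
    rintro x ⟨j, rfl⟩
    simp only [AddMonoidHom.mem_ker, AddMonoidHom.comp_apply, map_zsmul]
    have : (Submodule.span ℝ {φ c}).mkQ (φ c) = 0 := by simp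
    simp [this])

section Contraction

variable {A V ι : Type*} [AddCommGroup A] [AddCommGroup V] [Module ℝ V]

lemma contract_mk (φ : A →+ V) (c a : A) :
    contract φ c (QuotientAddGroup.mk a) = (Submodule.span ℝ {φ c}).mkQ (φ a) := rfl

lemma contract_eq_sum_iff (φ : A →+ V) (c a : A) (b : ι → A) (S : Finset ι) (l : ι → ℝ) :
    contract φ c (QuotientAddGroup.mk a) =
        ∑ i ∈ S, l i • contract φ c (QuotientAddGroup.mk (b i)) ↔
      ∃ t : ℝ, φ a + t • φ c = ∑ i ∈ S, l i • φ (b i) := by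
  simp only [contract_mk, ← map_smul, ← map_sum]
  rw [← sub_eq_zero, ← map_sub, Submodule.mkQ_apply, Submodule.Quotient.mk_eq_zero,
    Submodule.mem_span_singleton]
  constructor
  · rintro ⟨t, ht⟩
    exact ⟨-t, by rw [neg_smul, ht]; abel⟩
  · rintro ⟨t, ht⟩
    exact ⟨-t, by rw [← ht, neg_smul]; abel⟩

lemma zsmul_cast (φ : A →+ V) (a c : A) (j : ℤ) : φ (a + j • c) = φ a + (j : ℝ) • φ c := by
  rw [map_add, map_zsmul, Int.cast_smul_eq_zsmul]

lemma zsmul_right_cancel (φ : A →+ V) {c : A} (hc : φ c ≠ 0) {a : A} {j k : ℤ}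
    (h : a + j • c = a + k • c) : j = k := by
  have := congrArg φ h
  rw [zsmul_cast, zsmul_cast, add_right_inj] at this
  exact_mod_cast smul_left_injective ℝ hc this

lemma exists_eq_add_zsmul {a a' c : A}
    (h : (QuotientAddGroup.mk a : A ⧸ AddSubgroup.zmultiples c) = QuotientAddGroup.mk a') :
    ∃ j : ℤ, a' = a + j • c := by
  rw [QuotientAddGroup.eq] at h
  obtain ⟨j, hj⟩ := h
  exact ⟨j, by rw [show j • c = -a + a' from hj]; abel⟩

lemma mk_add_zsmul (a c : A) (j : ℤ) :
    (QuotientAddGroup.mk (a + j • c) : A ⧸ AddSubgroup.zmultiples c) = QuotientAddGroup.mk a := by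
  rw [eq_comm, QuotientAddGroup.eq]
  exact ⟨j, by simp⟩

/-- Sliding a window of integer length `k` along a bounded interval `T`. -/
lemma exists_int_window {T : Set ℝ} (hT : T.OrdConnected) (hne : T.Nonempty) (hb : BddAbove T)
    (k : ℕ) : ∃ M : ℤ, ∀ j : ℤ,
      ((∃ t ∈ T, (j : ℝ) - k ≤ t ∧ t ≤ j) ∧ (j : ℝ) ∉ T) ↔ (M < j ∧ j ≤ M + k) := by
  obtain ⟨B, hB⟩ := hb
  obtain ⟨t₀, ht₀⟩ := hne
  obtain ⟨M, ⟨t₁, ht₁, hM⟩, hmax⟩ := Int.exists_greatest_of_bdd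
    (P := fun z => ∃ t ∈ T, ⌊t⌋ = z)
    ⟨⌊B⌋, by rintro z ⟨t, ht, rfl⟩; exact Int.floor_le_floor (hB ht)⟩ ⟨_, t₀, ht₀, rfl⟩
  refine ⟨M, fun j => ⟨?_, ?_⟩⟩
  · rintro ⟨⟨t, ht, h1, h2⟩, hj⟩
    constructor
    · by_contra! hlt
      refine hj (hT.out ht ht₁ ⟨h2, ?_⟩)
      have : (j : ℝ) ≤ M := by exact_mod_cast hlt
      have := Int.floor_le t₁
      rw [hM] at this
      linarith
    · have h3 : ⌊t⌋ ≤ M := hmax _ ⟨t, ht, rfl⟩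
      have h4 : j - (k : ℤ) ≤ ⌊t⌋ := Int.le_floor.2 (by push_cast; exact h1)
      omega
  · rintro ⟨h1, h2⟩
    have hlt : ∀ t ∈ T, t < j := fun t ht =>
      Int.floor_lt.1 ((hmax _ ⟨t, ht, rfl⟩).trans_lt h1)
    refine ⟨⟨t₁, ht₁, ?_, (hlt _ ht₁).le⟩, fun h => (hlt _ h).false⟩
    have := Int.floor_le t₁
    rw [hM] at this
    have h3 : (j : ℝ) ≤ M + k := by exact_mod_cast h2
    linarith

lemma zonotopePts_mono (φ : A →+ V) (b : ι → A) {S S' : Finset ι} (h : S ⊆ S') (y : ι → ℕ) :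
    zonotopePts φ b S y ⊆ zonotopePts φ b S' y := by
  rintro a ⟨l, hl, ha⟩
  refine ⟨fun i => if i ∈ S then l i else 0, fun i _ => ?_, ?_⟩
  · by_cases hi : i ∈ S <;> simp [hi, hl]
  · rw [ha]
    refine Finset.sum_subset_zero_on_sdiff h (fun i hi => ?_) (fun i hi => ?_)
    · simp [(Finset.mem_sdiff.1 hi).2]
    · simp [hi]

lemma mem_zonotopePts_insert [DecidableEq ι] (φ : A →+ V) (b : ι → A) {S : Finset ι} {s : ι}
    (hs : s ∉ S) (y : ι → ℕ) (a : A) :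
    a ∈ zonotopePts φ b (insert s S) y ↔ ∃ t : ℝ, (0 ≤ t ∧ t ≤ y s) ∧ ∃ l : ι → ℝ,
      (∀ i ∈ S, 0 ≤ l i ∧ l i ≤ y i) ∧ φ a = t • φ (b s) + ∑ i ∈ S, l i • φ (b i) := by
  constructor
  · rintro ⟨l, hl, ha⟩
    rw [Finset.sum_insert hs] at ha
    exact ⟨l s, hl s (Finset.mem_insert_self _ _), l,
      fun i hi => hl i (Finset.mem_insert_of_mem hi), ha⟩
  · rintro ⟨t, ht, l, hl, ha⟩
    have hne : ∀ i ∈ S, i ≠ s := fun i hi h => hs (h ▸ hi)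
    refine ⟨Function.update l s t, fun i hi => ?_, ?_⟩
    · rcases Finset.mem_insert.1 hi with rfl | hi
      · simpa using ht
      · simpa [hne i hi] using hl i hi
    · rw [Finset.sum_insert hs, ha, Function.update_self]
      congr 1
      exact Finset.sum_congr rfl fun i hi => by rw [Function.update_of_ne (hne i hi)]

lemma zonotopePts_contract_finite [DecidableEq ι] (φ : A →+ V) (b : ι → A) {S : Finset ι} {s : ι}
    (hs : s ∉ S) (hfin : ∀ y, (zonotopePts φ b (insert s S) y).Finite) (y : ι → ℕ) :
    (zonotopePts (contract φ (b s)) (fun i => QuotientAddGroup.mk (b i)) S y).Finite := by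
  refine ((hfin (Function.update y s 1)).image
    (QuotientAddGroup.mk (s := AddSubgroup.zmultiples (b s)))).subset ?_
  intro q
  induction q using QuotientAddGroup.induction_on with | H a => ?_
  rintro ⟨l, hl, ha⟩
  obtain ⟨t, ht⟩ := (contract_eq_sum_iff φ (b s) a b S l).1 ha
  refine ⟨a + ⌈t⌉ • b s, (mem_zonotopePts_insert φ b hs _ _).2
    ⟨⌈t⌉ - t, ⟨?_, ?_⟩, l, fun i hi => ?_, ?_⟩, mk_add_zsmul _ _ _⟩
  · linarith [Int.le_ceil t]
  · simp only [Function.update_self, Nat.cast_one]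
    linarith [Int.ceil_lt_add_one t]
  · have : i ≠ s := fun h => hs (h ▸ hi)
    simpa [this] using hl i hi
  · rw [zsmul_cast, ← ht, sub_smul]
    abel

lemma ncard_zonotopePts_insert [DecidableEq ι] (φ : A →+ V) (b : ι → A) {S : Finset ι} {s : ι}
    (hs : s ∉ S) (hfin : ∀ y, (zonotopePts φ b (insert s S) y).Finite) (hc : φ (b s) ≠ 0)
    (y : ι → ℕ) :
    (zonotopePts φ b (insert s S) y).ncard = (zonotopePts φ b S y).ncard +
      y s * (zonotopePts (contract φ (b s)) (fun i => QuotientAddGroup.mk (b i)) S y).ncard := by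
  set Z' := zonotopePts (contract φ (b s))
    (fun i => (QuotientAddGroup.mk (b i) : A ⧸ AddSubgroup.zmultiples (b s))) S y
  have hsub := zonotopePts_mono φ b (Finset.subset_insert s S) y
  rw [← Set.ncard_sdiff_add_ncard_of_subset hsub (hfin y), add_comm]
  congr 1
  have key : ∀ q ∈ Z', ∃ r : A, QuotientAddGroup.mk r = q ∧ ∀ j : ℤ,
      r + j • b s ∈ zonotopePts φ b (insert s S) y \ zonotopePts φ b S y ↔
        j ∈ Finset.Ioc (0 : ℤ) (y s) := by
    intro q
    induction q using QuotientAddGroup.induction_on with | H a => ?_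
    rintro ⟨l₀, hl₀, ha₀⟩
    obtain ⟨t₀, ht₀⟩ := (contract_eq_sum_iff φ (b s) a b S l₀).1 ha₀
    let T : Set ℝ := {t | ∃ l : ι → ℝ, (∀ i ∈ S, 0 ≤ l i ∧ l i ≤ y i) ∧
      φ a + t • φ (b s) = ∑ i ∈ S, l i • φ (b i)}
    have hT : T.OrdConnected := by
      refine Convex.ordConnected ?_
      rintro t ⟨l, hl, h⟩ t' ⟨l', hl', h'⟩ u v hu hv huv
      refine ⟨fun i => u * l i + v * l' i, fun i hi => ⟨?_, ?_⟩, ?_⟩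
      · have := (hl i hi).1
        have := (hl' i hi).1
        positivity
      · calc u * l i + v * l' i ≤ u * y i + v * y i := by
              gcongr
              exacts [(hl i hi).2, (hl' i hi).2]
          _ = y i := by rw [← add_mul, huv, one_mul]
      · simp only [add_smul, mul_smul, Finset.sum_add_distrib, ← Finset.smul_sum, ← h, ← h',
          smul_add, smul_eq_mul]
        have : φ a = u • φ a + v • φ a := by rw [← add_smul, huv, one_smul]
        nth_rewrite 1 [this]
        abel
    have hmem : ∀ j : ℤ, a + j • b s ∈ zonotopePts φ b S y ↔ (j : ℝ) ∈ T := by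
      intro j
      simp only [zonotopePts, Set.mem_ofPred_eq, zsmul_cast, T]
    have hbdd : BddAbove T := by
      by_contra hnb
      have hall : ∀ m : ℕ, ((⌈t₀⌉ + m : ℤ) : ℝ) ∈ T := by
        intro m
        obtain ⟨t, ht, hlt⟩ := not_bddAbove_iff.1 hnb ((⌈t₀⌉ + m : ℤ) : ℝ)
        refine hT.out ⟨l₀, hl₀, ht₀⟩ ht ⟨?_, hlt.le⟩
        push_cast
        have := Int.le_ceil t₀
        have : (0 : ℝ) ≤ m := Nat.cast_nonneg m
        linarith
      refine Set.infinite_of_injective_forall_mem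
        (f := fun m : ℕ => a + (⌈t₀⌉ + m : ℤ) • b s) (fun m m' h => ?_)
        (fun m => (hmem _).2 (hall m)) ((hfin y).subset hsub)
      have := zsmul_right_cancel φ hc h
      omega
    obtain ⟨M, hM⟩ := exists_int_window hT ⟨t₀, l₀, hl₀, ht₀⟩ hbdd (y s)
    refine ⟨a + M • b s, mk_add_zsmul _ _ _, fun j => ?_⟩
    have hwin : a + M • b s + j • b s ∈ zonotopePts φ b (insert s S) y \ zonotopePts φ b S y ↔
        (∃ t ∈ T, ((M + j : ℤ) : ℝ) - y s ≤ t ∧ t ≤ (M + j : ℤ)) ∧ ((M + j : ℤ) : ℝ) ∉ T := by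
      rw [add_assoc, ← add_smul, Set.mem_sdiff, hmem, mem_zonotopePts_insert φ b hs]
      refine and_congr_left fun _ => ⟨?_, ?_⟩
      · rintro ⟨t, ⟨h0, h1⟩, l, hl, h⟩
        refine ⟨(M + j : ℤ) - t, ⟨l, hl, ?_⟩, by linarith, by linarith⟩
        rw [zsmul_cast] at h
        rw [sub_smul, ← add_sub_assoc, h]
        abel
      · rintro ⟨t, ⟨l, hl, h⟩, h0, h1⟩
        refine ⟨(M + j : ℤ) - t, ⟨by linarith, by linarith⟩, l, hl, ?_⟩
        rw [zsmul_cast, ← h, sub_smul]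
        abel
    rw [hwin, hM, Finset.mem_Ioc]
    omega
  choose! r hr hrj using key
  have himg : zonotopePts φ b (insert s S) y \ zonotopePts φ b S y =
      (fun p : (A ⧸ AddSubgroup.zmultiples (b s)) × ℤ => r p.1 + p.2 • b s) ''
        (Z' ×ˢ (Finset.Ioc (0 : ℤ) (y s) : Set ℤ)) := by
    ext a
    constructor
    · intro ha
      have hq : (QuotientAddGroup.mk a : A ⧸ AddSubgroup.zmultiples (b s)) ∈ Z' := by
        obtain ⟨t, -, l, hl, h⟩ := (mem_zonotopePts_insert φ b hs y a).1 ha.1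
        exact ⟨l, hl, (contract_eq_sum_iff φ (b s) a b S l).2
          ⟨-t, by rw [h, neg_smul]; abel⟩⟩
      obtain ⟨j, hj⟩ := exists_eq_add_zsmul (hr _ hq)
      exact ⟨(QuotientAddGroup.mk a, j), ⟨hq, (hrj _ hq j).1 (hj ▸ ha)⟩, hj.symm⟩
    · rintro ⟨⟨q, j⟩, ⟨hq, hj⟩, rfl⟩
      exact (hrj q hq j).2 hj
  rw [himg, Set.InjOn.ncard_image, Set.ncard_prod, Set.ncard_coe_finset]
  · simp [mul_comm]
  · rintro ⟨q, j⟩ ⟨hq, hj⟩ ⟨q', j'⟩ ⟨hq', hj'⟩ h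
    have hqq : q = q' := by
      rw [← hr q hq, ← hr q' hq', ← mk_add_zsmul (r q) _ j, ← mk_add_zsmul (r q') _ j']
      exact congrArg _ h
    subst hqq
    have hjj : j = j' := zsmul_right_cancel φ hc h
    rw [hjj]

lemma ncard_halfOpenPts_insert [DecidableEq ι] (φ : A →+ V) (b : ι → A) {G : Finset ι} {s : ι}
    (hs : s ∉ G)
    (hind : LinearIndepOn ℝ (fun i => φ (b i)) (insert s G : Finset ι)) :
    (halfOpenPts φ b (insert s G)).ncard =
      (halfOpenPts (contract φ (b s)) (fun i => QuotientAddGroup.mk (b i)) G).ncard := by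
  have himg : halfOpenPts (contract φ (b s)) (fun i => QuotientAddGroup.mk (b i)) G =
      QuotientAddGroup.mk (s := AddSubgroup.zmultiples (b s)) '' halfOpenPts φ b (insert s G) := by
    ext q
    constructor
    · induction q using QuotientAddGroup.induction_on with | H a => ?_
      rintro ⟨l, hl, ha⟩
      obtain ⟨t, ht⟩ := (contract_eq_sum_iff φ (b s) a b G l).1 ha
      have hne : ∀ i ∈ G, i ≠ s := fun i hi h => hs (h ▸ hi)
      refine ⟨a + ⌈t⌉ • b s, ⟨Function.update l s (⌈t⌉ - t), fun i hi => ?_, ?_⟩,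
        mk_add_zsmul _ _ _⟩
      · rcases Finset.mem_insert.1 hi with rfl | hi
        · simp only [Function.update_self]
          constructor <;> linarith [Int.le_ceil t, Int.ceil_lt_add_one t]
        · simpa [hne i hi] using hl i hi
      · rw [Finset.sum_insert hs, Function.update_self, zsmul_cast,
          Finset.sum_congr rfl fun i hi => by rw [Function.update_of_ne (hne i hi)], ← ht, sub_smul]
        abel
    · rintro ⟨a, ⟨l, hl, ha⟩, rfl⟩
      refine ⟨l, fun i hi => hl i (Finset.mem_insert_of_mem hi),
        (contract_eq_sum_iff φ (b s) a b G l).2 ⟨-l s, ?_⟩⟩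
      rw [ha, Finset.sum_insert hs, neg_smul]
      abel
  rw [himg, Set.InjOn.ncard_image]
  rintro a ⟨l, hl, ha⟩ a' ⟨l', hl', ha'⟩ h
  obtain ⟨j, rfl⟩ := exists_eq_add_zsmul h
  have h0 : ∑ i ∈ insert s G, (l i - l' i + if i = s then (j : ℝ) else 0) • φ (b i) = 0 := by
    simp only [add_smul, sub_smul, Finset.sum_add_distrib, Finset.sum_sub_distrib, ite_smul,
      zero_smul, Finset.sum_ite_eq', Finset.mem_insert_self, if_true]
    rw [← ha, ← ha', zsmul_cast]
    abel
  have h1 := linearIndepOn_finset_iff.1 hind _ h0 s (Finset.mem_insert_self _ _)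
  simp only [if_true] at h1
  have h2 := hl s (Finset.mem_insert_self _ _)
  have h3 := hl' s (Finset.mem_insert_self _ _)
  have h4 : (j : ℝ) < 1 := by linarith
  have h5 : (-1 : ℝ) < j := by linarith
  have h6 : j < 1 := by exact_mod_cast h4
  have h7 : -1 < j := by exact_mod_cast h5
  have : j = 0 := by omega
  simp [this]

lemma linearIndepOn_insert_iff_contract [DecidableEq ι] (φ : A →+ V) (b : ι → A) {G : Finset ι}
    {s : ι} (hs : s ∉ G) (hc : φ (b s) ≠ 0) :
    LinearIndepOn ℝ (fun i => φ (b i)) (insert s G : Finset ι) ↔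
      LinearIndepOn ℝ (fun i => contract φ (b s) (QuotientAddGroup.mk (b i))) (G : Set ι) := by
  have h1 : LinearIndepOn ℝ (fun i => φ (b i)) ({s} : Set ι) := by
    simpa [linearIndepOn_singleton_iff] using hc
  have h2 := h1.quotient_iff_union (t := (G : Set ι)) (by simpa using hs)
  rw [Finset.coe_insert, ← Set.singleton_union, ← h2, Set.image_singleton]
  rfl

/-- Lattice points of a zonotope, counted via linearly independent subsets of its generators. -/
theorem ncard_zonotopePts [DecidableEq ι] (S : Finset ι) (y : ι → ℕ) :
    ∀ {A : Type*} {V : Type*} [AddCommGroup A] [AddCommGroup V] [Module ℝ V]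
      (φ : A →+ V) (b : ι → A), (∀ y, (zonotopePts φ b S y).Finite) →
    (zonotopePts φ b S y).ncard = ∑ G ∈ S.powerset,
      if LinearIndepOn ℝ (fun i => φ (b i)) (G : Set ι) then
        (halfOpenPts φ b G).ncard * ∏ i ∈ G, y i else 0 := by
  induction S using Finset.induction_on with
  | empty =>
    intro A V _ _ _ φ b _
    simp [zonotopePts, halfOpenPts, LinearIndepOn]
  | insert s S hs ih =>
    intro A V _ _ _ φ b hfin
    have hfin' : ∀ y, (zonotopePts φ b S y).Finite := fun y =>
      (hfin y).subset (zonotopePts_mono φ b (Finset.subset_insert s S) y)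
    rw [Finset.sum_powerset_insert hs, ← ih φ b hfin']
    by_cases hc : φ (b s) = 0
    · rw [Finset.sum_eq_zero, add_zero]
      · congr 1
        refine (zonotopePts_mono φ b (Finset.subset_insert s S) y).antisymm' fun a ha => ?_
        obtain ⟨t, -, l, hl, h⟩ := (mem_zonotopePts_insert φ b hs y a).1 ha
        exact ⟨l, hl, by simpa [hc] using h⟩
      · intro G _
        rw [if_neg]
        intro h
        exact h.ne_zero (i := s) (by simp) hc
    · rw [ncard_zonotopePts_insert φ b hs hfin hc,
        ih _ _ (zonotopePts_contract_finite φ b hs hfin), Finset.mul_sum]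
      congr 1
      refine Finset.sum_congr rfl fun G hG => ?_
      have hsG : s ∉ G := fun h => hs (Finset.mem_powerset.1 hG h)
      by_cases hind : LinearIndepOn ℝ (fun i => φ (b i)) (insert s G : Finset ι)
      · rw [if_pos hind, if_pos ((linearIndepOn_insert_iff_contract φ b hsG hc).1 hind),
          ncard_halfOpenPts_insert φ b hsG hind, Finset.prod_insert hsG]
        ring
      · rw [if_neg hind, if_neg fun h =>
          hind ((linearIndepOn_insert_iff_contract φ b hsG hc).2 h), mul_zero]

end Contraction

/-- The inclusion `ℤ^d → ℝ^d` as a homomorphism. -/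
def toRHom (d : ℕ) : (Fin d → ℤ) →+ (Fin d → ℝ) where
  toFun := toR d
  map_zero' := by ext; simp [toR]
  map_add' x y := by ext; simp [toR]

lemma toRHom_apply (d : ℕ) (v : Fin d → ℤ) : toRHom d v = toR d v := rfl

lemma zonotopePts_finite (d n : ℕ) (b : Fin n → Fin d → ℤ) (S : Finset (Fin n)) (y : Fin n → ℕ) :
    (zonotopePts (toRHom d) b S y).Finite := by
  refine (Set.finite_Icc (fun j => -∑ i ∈ S, (y i : ℤ) * |b i j|)
    (fun j => ∑ i ∈ S, (y i : ℤ) * |b i j|)).subset ?_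
  rintro a ⟨l, hl, ha⟩
  have key : ∀ j, |a j| ≤ ∑ i ∈ S, (y i : ℤ) * |b i j| := by
    intro j
    have h := congrFun ha j
    simp only [toRHom_apply, toR, Finset.sum_apply, Pi.smul_apply, smul_eq_mul] at h
    have h2 : |(a j : ℝ)| ≤ ∑ i ∈ S, (y i : ℝ) * |(b i j : ℝ)| := by
      rw [h]
      refine (Finset.abs_sum_le_sum_abs _ _).trans (Finset.sum_le_sum fun i hi => ?_)
      rw [abs_mul, abs_of_nonneg (hl i hi).1]
      exact mul_le_mul_of_nonneg_right (hl i hi).2 (abs_nonneg _)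
    exact_mod_cast h2
  exact ⟨fun j => (abs_le.1 (key j)).1, fun j => (abs_le.1 (key j)).2⟩

lemma memMatroid_iff (d n : ℕ) (b : Fin n → Fin d → ℤ) (F : Finset (Fin n)) :
    memMatroid d n b F ↔ LinearIndepOn ℝ (fun i => toR d (b i)) (F : Set (Fin n)) := Iff.rfl

lemma finrank_span_image_eq_card {V ι : Type*} [AddCommGroup V] [Module ℝ V] {v : ι → V}
    {F : Finset ι} (h : LinearIndepOn ℝ v (F : Set ι)) :
    Module.finrank ℝ (Submodule.span ℝ (v '' F)) = F.card := by
  rw [Set.image_eq_range]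
  simpa using finrank_span_eq_card (R := ℝ) h

lemma card_le_of_memMatroid {d n : ℕ} {b : Fin n → Fin d → ℤ} {F : Finset (Fin n)}
    (h : memMatroid d n b F) : F.card ≤ d := by
  have h' : LinearIndependent ℝ (fun i : F => toR d (b i.1)) := h
  simpa using h'.fintype_card_le_finrank

lemma dimF_eq_card {d n : ℕ} {b : Fin n → Fin d → ℤ} {F : Finset (Fin n)}
    (h : memMatroid d n b F) : dimF d n b F = F.card :=
  finrank_span_image_eq_card h

lemma memMatroidRes_iff {d n : ℕ} {b : Fin n → Fin d → ℤ} {F : Finset (Fin n)}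
    (h : memMatroid d n b F) (G : Finset (Fin n)) :
    memMatroidRes d n b F G ↔ Disjoint F G ∧ memMatroid d n b (F ∪ G) := by
  have h' : LinearIndepOn ℝ (fun i => toR d (b i)) (F : Set (Fin n)) := h
  have hdis : (∀ i ∈ G, toR d (b i) ∉ spanF d n b F) → Disjoint F G := by
    intro hG
    rw [Finset.disjoint_left]
    exact fun i hF hi => hG i hi (Submodule.subset_span ⟨i, hF, rfl⟩)
  constructor
  · rintro ⟨h1, h2⟩
    refine ⟨hdis h1, ?_⟩
    rw [memMatroid_iff, Finset.coe_union]
    exact (h'.quotient_iff_union (Finset.disjoint_coe.2 (hdis h1))).1 h2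
  · rintro ⟨h1, h2⟩
    rw [memMatroid_iff, Finset.coe_union] at h2
    have h3 := (h'.quotient_iff_union (Finset.disjoint_coe.2 h1)).2 h2
    refine ⟨fun i hi hmem => h3.ne_zero (i := i) hi ?_, h3⟩
    exact (Submodule.Quotient.mk_eq_zero _).2 hmem

lemma ncard_halfOpenPts {d n : ℕ} {b : Fin n → Fin d → ℤ} {F : Finset (Fin n)}
    (h : memMatroid d n b F) :
    (halfOpenPts (toRHom d) b F).ncard = ∑ G ∈ F.powerset, boxCount d n b G := by
  have hfin : (halfOpenPts (toRHom d) b F).Finite := by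
    refine (zonotopePts_finite d n b F 1).subset ?_
    rintro a ⟨l, hl, ha⟩
    exact ⟨l, fun i hi => ⟨(hl i hi).1, by simpa using (hl i hi).2.le⟩, ha⟩
  have hsub : ∀ G ∈ F.powerset, {z : Fin d → ℤ | toR d z ∈ box d n b G} ⊆
      halfOpenPts (toRHom d) b F := by
    rintro G hG z ⟨α, hα, hz⟩
    refine ⟨fun i => if i ∈ G then α i else 0, fun i _ => ?_, ?_⟩
    · by_cases hi : i ∈ G
      · simpa [hi] using ⟨(hα i hi).1.le, (hα i hi).2⟩
      · simp [hi]
    · rw [toRHom_apply, hz]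
      refine Finset.sum_subset_zero_on_sdiff (Finset.mem_powerset.1 hG) (fun i hi => ?_)
        (fun i hi => ?_)
      · simp [(Finset.mem_sdiff.1 hi).2]
      · simp [hi, toRHom_apply]
  have hsupp : ∀ (z : Fin d → ℤ) (G : Finset (Fin n)), G ⊆ F → toR d z ∈ box d n b G →
      ∀ l : Fin n → ℝ, toR d z = ∑ i ∈ F, l i • toR d (b i) → G = {i ∈ F | l i ≠ 0} := by
    rintro z G hG ⟨α, hα, hz⟩ l hl
    have h0 : ∑ i ∈ F, (l i - if i ∈ G then α i else 0) • toR d (b i) = 0 := by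
      simp only [sub_smul, Finset.sum_sub_distrib, ite_smul, zero_smul]
      rw [← hl, hz, ← Finset.sum_filter, Finset.filter_mem_eq_inter,
        Finset.inter_eq_right.2 hG, sub_self]
    have h1 := linearIndepOn_finset_iff.1 ((memMatroid_iff d n b F).1 h) _ h0
    ext i
    rw [Finset.mem_filter]
    constructor
    · intro hi
      refine ⟨hG hi, ?_⟩
      have := h1 i (hG hi)
      rw [if_pos hi, sub_eq_zero] at this
      exact this ▸ (hα i hi).1.ne'
    · rintro ⟨hi, hne⟩
      by_contra hiG
      have := h1 i hi
      rw [if_neg hiG, sub_zero] at this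
      exact hne this
  have hset : ∀ G ∈ F.powerset, boxCount d n b G =
      {z ∈ hfin.toFinset | toR d z ∈ box d n b G}.card := by
    intro G hG
    rw [boxCount, Nat.card_coe_set_eq, ← Set.ncard_coe_finset]
    congr 1
    ext z
    simp only [Finset.coe_filter, Set.Finite.mem_toFinset, Set.mem_ofPred_eq]
    exact ⟨fun hz => ⟨hsub G hG hz, hz⟩, fun hz => hz.2⟩
  rw [Finset.sum_congr rfl hset, ← Finset.card_biUnion, Set.ncard_eq_toFinset_card _ hfin]
  · congr 1
    ext z
    simp only [Set.Finite.mem_toFinset, Finset.mem_biUnion, Finset.mem_filter]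
    refine ⟨?_, fun ⟨G, _, hz, _⟩ => hz⟩
    intro hz
    obtain ⟨l, hl, hzl⟩ := id hz
    refine ⟨{i ∈ F | l i ≠ 0}, Finset.mem_powerset.2 (Finset.filter_subset _ _), hz, l,
      fun i hi => ?_, ?_⟩
    · obtain ⟨hi, hne⟩ := Finset.mem_filter.1 hi
      exact ⟨(hl i hi).1.lt_of_ne hne.symm, (hl i hi).2⟩
    · rw [← toRHom_apply, hzl]
      refine (Finset.sum_subset (Finset.filter_subset _ _) fun i hi hn => ?_).symm
      have : l i = 0 := by
        by_contra hne
        exact hn (Finset.mem_filter.2 ⟨hi, hne⟩)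
      simp [this]
  · intro G hG G' hG' hne
    rw [Function.onFun, Finset.disjoint_left]
    intro z hz hz'
    obtain ⟨hzm, hz⟩ := Finset.mem_filter.1 hz
    obtain ⟨-, hz'⟩ := Finset.mem_filter.1 hz'
    obtain ⟨l, -, hzl⟩ := hfin.mem_toFinset.1 hzm
    exact hne ((hsupp z G (Finset.mem_powerset.1 hG) hz l hzl).trans
      (hsupp z G' (Finset.mem_powerset.1 hG') hz' l hzl).symm)

lemma mem_lawrencePolytope_iff (d n : ℕ) (b : Fin n → Fin d → ℤ) (x : Fin d → ℝ)
    (w : Fin n → ℝ) :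
    (x, w) ∈ lawrencePolytope d n b ↔ ∑ i, w i = 1 ∧ ∃ l : Fin n → ℝ,
      (∀ i, 0 ≤ l i ∧ l i ≤ w i) ∧ x = ∑ i, l i • toR d (b i) := by
  constructor
  · let Q : Set ((Fin d → ℝ) × (Fin n → ℝ)) := {p | ∑ i, p.2 i = 1 ∧ ∃ l : Fin n → ℝ,
      (∀ i, 0 ≤ l i ∧ l i ≤ p.2 i) ∧ p.1 = ∑ i, l i • toR d (b i)}
    have hQ : Convex ℝ Q := by
      rintro ⟨x, w⟩ ⟨hw, l, hl, hx⟩ ⟨x', w'⟩ ⟨hw', l', hl', hx'⟩ u v hu hv huv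
      simp only at hw hw' hl hl' hx hx'
      refine ⟨?_, fun i => u * l i + v * l' i, fun i => ⟨?_, ?_⟩, ?_⟩
      · simp [Finset.sum_add_distrib, ← Finset.mul_sum, hw, hw', huv]
      · have := (hl i).1
        have := (hl' i).1
        positivity
      · have h1 := mul_le_mul_of_nonneg_left (hl i).2 hu
        have h2 := mul_le_mul_of_nonneg_left (hl' i).2 hv
        simpa using add_le_add h1 h2
      · simp [hx, hx', add_smul, mul_smul, Finset.sum_add_distrib, Finset.smul_sum]
    intro h
    refine (convexHull_min ?_ hQ : _ ⊆ Q) h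
    rintro p (⟨i, rfl⟩ | ⟨i, rfl⟩)
    · refine ⟨by simp [e], Pi.single i 1, fun j => ⟨?_, le_rfl⟩, ?_⟩
      · by_cases hj : j = i
        · subst hj; simp
        · simp [hj]
      · simp [Pi.single_apply]
    · refine ⟨by simp [e], 0, fun j => ⟨le_rfl, ?_⟩, by simp⟩
      by_cases hj : j = i
      · subst hj; simp [e]
      · simp [e, hj]
  · rintro ⟨hw, l, hl, hx⟩
    have h := (convex_convexHull ℝ ((Set.range fun i => (toR d (b i), e n i)) ∪
      (Set.range fun i => ((0 : Fin d → ℝ), e n i)))).sum_mem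
      (t := (Finset.univ : Finset (Fin n ⊕ Fin n)))
      (w := Sum.elim l (fun i => w i - l i))
      (z := Sum.elim (fun i => (toR d (b i), e n i)) (fun i => ((0 : Fin d → ℝ), e n i)))
      ?_ ?_ ?_
    · rw [lawrencePolytope]
      convert h using 1
      rw [Fintype.sum_sum_type]
      refine Prod.ext ?_ ?_
      · simp [hx, Prod.fst_sum]
      · simp only [Sum.elim_inl, Sum.elim_inr, Prod.snd_add, Prod.snd_sum, Prod.smul_snd,
          ← Finset.sum_add_distrib, ← add_smul, add_sub_cancel]
        ext j
        simp [e, Pi.single_apply]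
    · rintro (i | i) _
      · exact (hl i).1
      · exact sub_nonneg.2 (hl i).2
    · rw [Fintype.sum_sum_type]
      simp [hw]
    · rintro (i | i) _
      · exact subset_convexHull _ _ (Or.inl ⟨i, rfl⟩)
      · exact subset_convexHull _ _ (Or.inr ⟨i, rfl⟩)

lemma mem_smul_lawrencePolytope_iff (d n : ℕ) (hn : 0 < n) (b : Fin n → Fin d → ℤ) (m : ℕ)
    (x : Fin d → ℝ) (w : Fin n → ℝ) :
    (x, w) ∈ (m : ℝ) • lawrencePolytope d n b ↔ ∑ i, w i = m ∧ ∃ l : Fin n → ℝ,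
      (∀ i, 0 ≤ l i ∧ l i ≤ w i) ∧ x = ∑ i, l i • toR d (b i) := by
  constructor
  · rintro ⟨⟨x', w'⟩, hp, hxw⟩
    obtain ⟨hw, l, hl, hx⟩ := (mem_lawrencePolytope_iff d n b x' w').1 hp
    obtain ⟨rfl, rfl⟩ := Prod.mk.inj hxw
    refine ⟨?_, fun i => m * l i, fun i => ⟨?_, ?_⟩, ?_⟩
    · simp [← Finset.mul_sum, hw]
    · have := (hl i).1
      positivity
    · exact mul_le_mul_of_nonneg_left (hl i).2 m.cast_nonneg
    · simp [hx, Finset.smul_sum, mul_smul]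
  · rintro ⟨hw, l, hl, hx⟩
    rcases Nat.eq_zero_or_pos m with rfl | hm
    · have hw0 : ∀ i, w i = 0 := fun i =>
        (Finset.sum_eq_zero_iff_of_nonneg fun i _ => (hl i).1.trans (hl i).2).1
          (by simpa using hw) i (Finset.mem_univ i)
      have hl0 : ∀ i, l i = 0 := fun i => le_antisymm ((hl i).2.trans (hw0 i).le) (hl i).1
      refine ⟨(0, e n ⟨0, hn⟩), subset_convexHull _ _ (Or.inr ⟨⟨0, hn⟩, rfl⟩), ?_⟩
      refine Prod.ext ?_ ?_
      · simp [hx, hl0]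
      · ext i
        simp [hw0]
    · have hm' : (0 : ℝ) < m := Nat.cast_pos.2 hm
      refine (Set.mem_smul_set_iff_inv_smul_mem₀ hm'.ne' _ _).2
        ((mem_lawrencePolytope_iff d n b _ _).2
          ⟨?_, fun i => (m : ℝ)⁻¹ * l i, fun i => ⟨?_, ?_⟩, ?_⟩)
      · simp [← Finset.mul_sum, hw, hm'.ne']
      · have := (hl i).1
        positivity
      · exact mul_le_mul_of_nonneg_left (hl i).2 (by positivity)
      · simp [hx, Finset.smul_sum, mul_smul]

lemma latticeCount_lawrencePolytope (d n : ℕ) (hn : 0 < n) (b : Fin n → Fin d → ℤ) (m : ℕ) :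
    latticeCount d n (lawrencePolytope d n b) m =
      ∑ y ∈ (Finset.univ : Finset (Fin n)).finsuppAntidiag m,
        (zonotopePts (toRHom d) b Finset.univ y).ncard := by
  have hset : {z : (Fin d → ℤ) × (Fin n → ℤ) |
      (toR d z.1, fun j => (z.2 j : ℝ)) ∈ (m : ℝ) • lawrencePolytope d n b} =
      (fun p : Σ _ : Fin n →₀ ℕ, (Fin d → ℤ) => (p.2, fun j => (p.1 j : ℤ))) ''
        (((Finset.univ : Finset (Fin n)).finsuppAntidiag m).sigma
          fun y => (zonotopePts_finite d n b Finset.univ y).toFinset : Finset _) := by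
    ext ⟨a, w⟩
    simp only [Set.mem_ofPred_eq, mem_smul_lawrencePolytope_iff d n hn b, Set.mem_image,
      Finset.mem_coe, Finset.mem_sigma, Finset.mem_finsuppAntidiag, Set.Finite.mem_toFinset]
    constructor
    · rintro ⟨hw, l, hl, hx⟩
      have hw0 : ∀ i, 0 ≤ w i := fun i => by exact_mod_cast (hl i).1.trans (hl i).2
      have hcast : ∀ i, (((w i).toNat : ℕ) : ℝ) = w i := fun i => by
        exact_mod_cast Int.toNat_of_nonneg (hw0 i)
      refine ⟨⟨Finsupp.equivFunOnFinite.symm fun i => (w i).toNat, a⟩,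
        ⟨⟨?_, Finset.subset_univ _⟩, l, fun i _ => ?_, hx⟩, ?_⟩
      · have : ((∑ i, (w i).toNat : ℕ) : ℝ) = m := by
          rw [← hw, Nat.cast_sum]
          exact Finset.sum_congr rfl fun i _ => hcast i
        exact_mod_cast this
      · simpa [hcast] using hl i
      · ext1
        · rfl
        · ext i
          simpa using hw0 i
    · rintro ⟨⟨y, a'⟩, ⟨⟨hy, -⟩, l, hl, hx⟩, h⟩
      obtain ⟨rfl, rfl⟩ := Prod.mk.inj h
      refine ⟨?_, l, fun i => by simpa using hl i (Finset.mem_univ i), hx⟩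
      simp only [Int.cast_natCast]
      exact_mod_cast hy
  rw [latticeCount, Nat.card_coe_set_eq, hset, Set.InjOn.ncard_image, Set.ncard_coe_finset,
    Finset.card_sigma]
  · exact Finset.sum_congr rfl fun y _ => (Set.ncard_eq_toFinset_card _ _).symm
  · rintro ⟨y, a⟩ - ⟨y', a'⟩ - h
    obtain ⟨rfl, h2⟩ := Prod.mk.inj h
    have : y = y' := by
      ext i
      exact_mod_cast congrFun h2 i
    rw [this]

lemma mk_natCast_mul_one_sub_sq :
    PowerSeries.mk (fun k => (k : ℤ)) * (1 - PowerSeries.X) ^ 2 = PowerSeries.X := by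
  have h1 : PowerSeries.mk (fun k => (k : ℤ)) * (1 - PowerSeries.X) =
      PowerSeries.X * PowerSeries.mk 1 := by
    ext k
    rw [mul_sub, mul_one, map_sub, mul_comm PowerSeries.X]
    cases k with
    | zero => simp
    | succ k => simp [PowerSeries.coeff_succ_mul_X]
  rw [pow_two, ← mul_assoc, h1, mul_assoc, PowerSeries.mk_one_mul_one_sub_eq_one, mul_one]

lemma one_sub_pow_mul_prod {d n : ℕ} {F : Finset (Fin n)} (hF : F.card ≤ d) :
    (1 - PowerSeries.X) ^ (n + d) *
      ∏ i, (if i ∈ F then PowerSeries.mk (fun k => (k : ℤ)) else PowerSeries.mk 1) =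
    PowerSeries.X ^ F.card * (1 - PowerSeries.X) ^ (d - F.card) := by
  have hn : F.card ≤ n := by simpa using F.card_le_univ
  have hcompl : (Finset.univ.filter fun i => i ∉ F).card = n - F.card := by
    rw [← Finset.compl_filter, Finset.card_compl]
    simp
  rw [Finset.prod_ite, Finset.prod_const, Finset.prod_const, hcompl, Finset.filter_mem_eq_inter,
    Finset.univ_inter,
    show n + d = 2 * F.card + (n - F.card) + (d - F.card) by omega, pow_add, pow_add, pow_mul]
  calc _ = (PowerSeries.mk (fun k => (k : ℤ)) * (1 - PowerSeries.X) ^ 2) ^ F.card *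
        ((PowerSeries.mk (1 : ℕ → ℤ)) * (1 - PowerSeries.X)) ^ (n - F.card) *
        (1 - PowerSeries.X) ^ (d - F.card) := by rw [mul_pow, mul_pow]; ring
    _ = _ := by rw [mk_natCast_mul_one_sub_sq, PowerSeries.mk_one_mul_one_sub_eq_one, one_pow,
        mul_one]

lemma mk_latticeCount (d n : ℕ) (hn : 0 < n) (b : Fin n → Fin d → ℤ) :
    PowerSeries.mk (fun m => (latticeCount d n (lawrencePolytope d n b) m : ℤ)) =
      ∑ F : Finset (Fin n), if memMatroid d n b F then
        PowerSeries.C ((halfOpenPts (toRHom d) b F).ncard : ℤ) *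
          ∏ i, (if i ∈ F then PowerSeries.mk (fun k => (k : ℤ)) else PowerSeries.mk 1)
      else 0 := by
  ext m
  rw [PowerSeries.coeff_mk, latticeCount_lawrencePolytope d n hn, map_sum, Nat.cast_sum,
    Finset.sum_congr rfl fun y _ => congrArg Nat.cast (ncard_zonotopePts Finset.univ _ _ b
      (zonotopePts_finite d n b Finset.univ))]
  simp only [Finset.powerset_univ, Nat.cast_sum]
  rw [Finset.sum_comm]
  refine Finset.sum_congr rfl fun F _ => ?_
  change ∑ y ∈ _, ((if memMatroid d n b F then _ else _ : ℕ) : ℤ) = _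
  by_cases hF : memMatroid d n b F
  · simp only [if_pos hF]
    rw [PowerSeries.coeff_C_mul, PowerSeries.coeff_prod, Finset.mul_sum]
    refine Finset.sum_congr rfl fun y _ => ?_
    have : ∀ i, (PowerSeries.coeff (y i)) (if i ∈ F then PowerSeries.mk (fun k => (k : ℤ))
        else PowerSeries.mk 1) = if i ∈ F then (y i : ℤ) else 1 := by
      intro i
      split_ifs <;> simp
    simp only [this]
    rw [Finset.prod_ite_mem, Finset.univ_inter]
    push_cast
    rfl
  · simp [if_neg hF]

lemma hPoly_eq {d n : ℕ} {b : Fin n → Fin d → ℤ} {F : Finset (Fin n)}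
    (h : memMatroid d n b F) :
    X ^ F.card * hPoly d n b F = ∑ E : Finset (Fin n),
      if F ⊆ E ∧ memMatroid d n b E then X ^ E.card * (1 - X : ℤ[X]) ^ (d - E.card) else 0 := by
  have hcard : ∀ G, memMatroidRes d n b F G → dimRes d n b F G = G.card := fun G hG =>
    finrank_span_image_eq_card (v := fun i => (spanF d n b F).mkQ (toR d (b i))) hG.2
  have hunion : ∀ G, memMatroidRes d n b F G → (F ∪ G).card = F.card + G.card := fun G hG =>
    Finset.card_union_of_disjoint ((memMatroidRes_iff h G).1 hG).1
  have hle : ∀ G, memMatroidRes d n b F G → F.card + G.card ≤ d := fun G hG => by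
    rw [← hunion G hG]
    exact card_le_of_memMatroid ((memMatroidRes_iff h G).1 hG).2
  have hf : ∀ i, fRes d n b F i =
      {G ∈ Finset.univ.filter (memMatroidRes d n b F) | G.card = i}.card := by
    intro i
    rw [fRes, Nat.card_coe_set_eq, ← Set.ncard_coe_finset]
    congr 1
    ext G
    simp only [Set.mem_ofPred_eq, Finset.coe_filter, Finset.mem_filter, Finset.mem_univ, true_and]
    exact and_congr_right fun hG => by rw [hcard G hG]
  have hsum : hPoly d n b F = ∑ G ∈ Finset.univ.filter (memMatroidRes d n b F),
      X ^ G.card * (1 - X : ℤ[X]) ^ (d - F.card - G.card) := by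
    rw [hPoly, dimF_eq_card h, ← Finset.sum_fiberwise_of_maps_to (g := Finset.card)
      (t := Finset.range (d - F.card + 1))]
    · refine Finset.sum_congr rfl fun i _ => ?_
      rw [Finset.sum_congr rfl fun G hG => by rw [(Finset.mem_filter.1 hG).2], Finset.sum_const,
        ← hf, nsmul_eq_mul, mul_assoc]
      simp
    · intro G hG
      have := hle G (Finset.mem_filter.1 hG).2
      rw [Finset.mem_range]
      omega
  rw [hsum, ← Finset.sum_filter, Finset.mul_sum]
  refine Finset.sum_nbij' (F ∪ ·) (· \ F) ?_ ?_ ?_ ?_ ?_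
  · intro G hG
    simp only [Finset.mem_filter, Finset.mem_univ, true_and] at hG ⊢
    exact ⟨Finset.subset_union_left, ((memMatroidRes_iff h G).1 hG).2⟩
  · intro E hE
    simp only [Finset.mem_filter, Finset.mem_univ, true_and] at hE ⊢
    rw [memMatroidRes_iff h, Finset.union_sdiff_of_subset hE.1]
    exact ⟨Finset.disjoint_sdiff, hE.2⟩
  · intro G hG
    exact Finset.union_sdiff_cancel_left
      ((memMatroidRes_iff h G).1 (Finset.mem_filter.1 hG).2).1
  · intro E hE
    exact Finset.union_sdiff_of_subset (Finset.mem_filter.1 hE).2.1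
  · intro G hG
    have hG := (Finset.mem_filter.1 hG).2
    rw [hunion G hG, ← mul_assoc, ← pow_add, Nat.sub_sub]

/-- `δ_B(t) = Σ_{F ∈ M_B} #(BOX(F) ∩ ℤ^d) t^{dim F} h_F(t)`. -/
theorem statement0 (d n : ℕ) (hd : 0 < d) (hn : 0 < n)
    (b : Fin n → Fin d → ℤ) (hb : ∀ i, b i ≠ 0)
    (hgen : Submodule.span ℤ (Set.range b) = ⊤)
    (δ : Polynomial ℤ) (hδ : IsDeltaPoly d n (lawrencePolytope d n b) δ) :
    δ = ∑ F : Finset (Fin n),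
      if memMatroid d n b F then
        C (boxCount d n b F : ℤ) * X ^ dimF d n b F * hPoly d n b F
      else 0 := by
  have key : δ = ∑ E : Finset (Fin n), if memMatroid d n b E then
      C ((halfOpenPts (toRHom d) b E).ncard : ℤ) * (X ^ E.card * (1 - X) ^ (d - E.card))
      else 0 := by
    rw [← Polynomial.coe_inj, ← hδ.2, mk_latticeCount d n hn, Finset.mul_sum,
      ← Polynomial.coeToPowerSeries.ringHom_apply, map_sum]
    refine Finset.sum_congr rfl fun E _ => ?_
    by_cases hE : memMatroid d n b E
    · rw [if_pos hE, if_pos hE, mul_left_comm, one_sub_pow_mul_prod (card_le_of_memMatroid hE),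
        Polynomial.coeToPowerSeries.ringHom_apply]
      simp only [Polynomial.coe_mul, Polynomial.coe_C, Polynomial.coe_pow, Polynomial.coe_X,
        Polynomial.coe_sub, Polynomial.coe_one]
    · rw [if_neg hE, if_neg hE, mul_zero, map_zero]
  have hR : ∀ F : Finset (Fin n), (if memMatroid d n b F then
      C (boxCount d n b F : ℤ) * X ^ dimF d n b F * hPoly d n b F else 0) =
      ∑ E : Finset (Fin n), if F ⊆ E ∧ memMatroid d n b E then
        C (boxCount d n b F : ℤ) * (X ^ E.card * (1 - X) ^ (d - E.card)) else 0 := by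
    intro F
    by_cases hF : memMatroid d n b F
    · rw [if_pos hF, dimF_eq_card hF, mul_assoc, hPoly_eq hF, Finset.mul_sum]
      exact Finset.sum_congr rfl fun E _ => by rw [mul_ite, mul_zero]
    · rw [if_neg hF, Finset.sum_eq_zero]
      intro E _
      rw [if_neg]
      rintro ⟨hFE, hE⟩
      exact hF (LinearIndepOn.mono (v := fun i => toR d (b i)) hE (Finset.coe_subset.2 hFE))
  rw [key, Finset.sum_congr rfl fun F _ => hR F, Finset.sum_comm]
  refine Finset.sum_congr rfl fun E _ => ?_
  by_cases hE : memMatroid d n b E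
  · simp only [hE, and_true, if_true]
    rw [← Finset.sum_filter, ← Finset.sum_mul, ncard_halfOpenPts hE, Nat.cast_sum, map_sum]
    congr 2
    ext F
    simp
  · simp [hE]

end LawrencePaper
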